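/- Let Σ be an alphabet with |Σ| = k. If each factor of a recurrent infinite word over Σ has at most k abelian returns, then the word is periodic. -/

import Mathlib

variable {α : Type*}

/-- The factor of the infinite word `w` of length `n` starting at position `i`. -/
def factorAt (w : ℕ → α) (i n : ℕ) : List α :=
  (List.range n).map fun k => w (i + k)

/-- `u` is a factor of the infinite word `w`. -/
def IsFactor (w : ℕ → α) (u : List α) : Prop :=
  ∃ i, factorAt w i u.length = u

/-- `w` is recurrent: each of its factors occurs infinitely many times. -/
def Recurrent (w : ℕ → α) : Prop :=
  ∀ u : List α, IsFactor w u → ∀ N : ℕ, ∃ i, N ≤ i ∧ factorAt w i u.length = u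

/-- `w` is periodic: there is `T > 0` with `w (n + T) = w n` for all `n`. -/
def Periodic (w : ℕ → α) : Prop :=
  ∃ T : ℕ, 0 < T ∧ ∀ n, w (n + T) = w n

def Aperiodic (w : ℕ → α) : Prop := ¬ Periodic w

def UltimatelyPeriodic (w : ℕ → α) : Prop :=
  ∃ N T : ℕ, 0 < T ∧ ∀ n, N ≤ n → w (n + T) = w n

/-- `w` is Sturmian: aperiodic with subword complexity `n + 1`. -/
def Sturmian (w : ℕ → α) : Prop :=
  Aperiodic w ∧ ∀ n : ℕ, {u : List α | u.length = n ∧ IsFactor w u}.ncard = n + 1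

/-- Positions where `u` occurs in `w`. -/
def Occurrences (w : ℕ → α) (u : List α) : Set ℕ :=
  {i | factorAt w i u.length = u}

/-- The return words of `u` in `w`: words from one occurrence of `u` to the next. -/
def ReturnWords (w : ℕ → α) (u : List α) : Set (List α) :=
  {r | ∃ i j : ℕ, i ∈ Occurrences w u ∧ j ∈ Occurrences w u ∧ i < j ∧
    (∀ k, i < k → k < j → k ∉ Occurrences w u) ∧ r = factorAt w i (j - i)}

/-- Positions where a word abelian-equivalent to `u` occurs in `w`. -/
def AbelianOccurrences (w : ℕ → α) (u : List α) : Set ℕ :=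
  {i | List.Perm (factorAt w i u.length) u}

/-- The abelian return words of `u` in `w`. -/
def AbelianReturnWords (w : ℕ → α) (u : List α) : Set (List α) :=
  {r | ∃ i j : ℕ, i ∈ AbelianOccurrences w u ∧ j ∈ AbelianOccurrences w u ∧ i < j ∧
    (∀ k, i < k → k < j → k ∉ AbelianOccurrences w u) ∧ r = factorAt w i (j - i)}

/-- The abelian equivalence classes (as multisets) of the abelian return words of `u` in `w`. -/
def abelianReturnClasses (w : ℕ → α) (u : List α) : Set (Multiset α) :=
  (fun r : List α => (r : Multiset α)) '' AbelianReturnWords w u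

def RightSpecial (w : ℕ → α) (u : List α) : Prop :=
  ∃ a b : α, a ≠ b ∧ IsFactor w (u ++ [a]) ∧ IsFactor w (u ++ [b])

def LeftSpecial (w : ℕ → α) (u : List α) : Prop :=
  ∃ a b : α, a ≠ b ∧ IsFactor w (a :: u) ∧ IsFactor w (b :: u)

def Bispecial (w : ℕ → α) (u : List α) : Prop :=
  RightSpecial w u ∧ LeftSpecial w u

/-- A factor is singular if it is the only factor of `w` in its abelian class. -/
def Singular (w : ℕ → α) (u : List α) : Prop :=
  ∀ v : List α, IsFactor w v → List.Perm v u → v = u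

/-- `w` is an infinite concatenation of words from `S`. -/
def InfConcat (S : Set (List α)) (w : ℕ → α) : Prop :=
  ∃ f : ℕ → List α, (∀ n, f n ∈ S) ∧
    ∀ n, factorAt w (((List.range n).map fun k => (f k).length).sum) (f n).length = f n

/-- A finite binary word is balanced if any two factors of equal length have numbers
of occurrences of `true` differing by at most one. -/
def BalancedList (w : List Bool) : Prop :=
  ∀ u v : List Bool, u <:+: w → v <:+: w → u.length = v.length →
    |(u.count true : ℤ) - (v.count true : ℤ)| ≤ 1


@[simp] theorem length_factorAt (w : ℕ → α) (i n : ℕ) : (factorAt w i n).length = n := by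
  simp [factorAt]

theorem factorAt_succ (w : ℕ → α) (i n : ℕ) :
    factorAt w i (n + 1) = factorAt w i n ++ [w (i + n)] := by
  simp [factorAt, List.range_succ]

theorem factorAt_succ_eq_cons (w : ℕ → α) (i n : ℕ) :
    factorAt w i (n + 1) = w i :: factorAt w (i + 1) n := by
  simp [factorAt, List.range_succ_eq_map, Nat.add_assoc, Nat.add_comm 1]

theorem isFactor_factorAt (w : ℕ → α) (i n : ℕ) : IsFactor w (factorAt w i n) :=
  ⟨i, by rw [length_factorAt]⟩

/-- Shifting a window by one preserves its abelian class exactly when the letter that leaves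
equals the letter that enters. -/
theorem factorAt_succ_perm_iff (w : ℕ → α) (i n : ℕ) :
    (factorAt w (i + 1) n).Perm (factorAt w i n) ↔ w (i + n) = w i := by
  have key : w i ::ₘ (factorAt w (i + 1) n : Multiset α) =
      w (i + n) ::ₘ (factorAt w i n : Multiset α) := by
    rw [Multiset.cons_coe, Multiset.cons_coe, Multiset.coe_eq_coe,
      ← factorAt_succ_eq_cons, factorAt_succ]
    exact List.perm_append_singleton _ _
  rw [← Multiset.coe_eq_coe]
  constructor
  · intro h
    rw [h] at key
    exact ((Multiset.cons_inj_left _).1 key).symm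
  · intro h
    rw [h] at key
    exact (Multiset.cons_inj_right _).1 key

theorem factorAt_perm_of_forall_lt {w : ℕ → α} {n m : ℕ} (h : ∀ i < m, w (i + n) = w i) :
    ∀ i ≤ m, (factorAt w i n).Perm (factorAt w 0 n) := by
  intro i
  induction i with
  | zero => exact fun _ => List.Perm.refl _
  | succ i ih =>
    exact fun hi => ((factorAt_succ_perm_iff w i n).2 (h i hi)).trans (ih (Nat.le_of_succ_le hi))

theorem Recurrent.exists_lt_mem_abelianOccurrences {w : ℕ → α} (hrec : Recurrent w)
    {u : List α} (hu : IsFactor w u) (m : ℕ) : ∃ j, m < j ∧ j ∈ AbelianOccurrences w u := by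
  obtain ⟨j, hj, hju⟩ := hrec u hu (m + 1)
  exact ⟨j, hj, List.Perm.of_eq hju⟩

theorem singleton_mem_abelianReturnClasses {w : ℕ → α} {u : List α} {i : ℕ}
    (hi : i ∈ AbelianOccurrences w u) (hi' : i + 1 ∈ AbelianOccurrences w u) :
    {w i} ∈ abelianReturnClasses w u :=
  ⟨[w i], ⟨i, i + 1, hi, hi', i.lt_succ_self, fun _ _ _ => by omega, by simp [factorAt]⟩, rfl⟩

/-- An abelian occurrence not immediately followed by another one yields an abelian return
of length at least two. -/
theorem Recurrent.exists_one_lt_card_mem_abelianReturnClasses {w : ℕ → α} (hrec : Recurrent w)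
    {u : List α} (hu : IsFactor w u) {m : ℕ} (hm : m ∈ AbelianOccurrences w u)
    (hm' : m + 1 ∉ AbelianOccurrences w u) :
    ∃ r ∈ abelianReturnClasses w u, 1 < r.card := by
  classical
  have hex := hrec.exists_lt_mem_abelianOccurrences hu m
  obtain ⟨hlt, hmem⟩ := Nat.find_spec hex
  refine ⟨_, ⟨_, ⟨m, Nat.find hex, hm, hmem, hlt,
    fun k hk hkj hku => Nat.find_min hex hkj ⟨hk, hku⟩, rfl⟩, rfl⟩, ?_⟩
  have hne : Nat.find hex ≠ m + 1 := fun h => hm' (h ▸ hmem)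
  simp only [Multiset.coe_card, length_factorAt]
  omega

theorem Recurrent.exists_pos_forall_lt {w : ℕ → α} (hrec : Recurrent w) (L : ℕ) :
    ∃ n, 0 < n ∧ ∀ i < L, w (i + n) = w i := by
  obtain ⟨n, hn, hnL⟩ := hrec _ (isFactor_factorAt w 0 L) 1
  refine ⟨n, hn, fun i hi => ?_⟩
  rw [length_factorAt] at hnL
  have := List.map_inj_left.1 hnL i (List.mem_range.2 hi)
  simpa [Nat.add_comm] using this

/-- If each factor of a recurrent infinite word over an alphabet Σ with
`|Σ| = k` has at most `k` abelian returns, then the word is periodic. -/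
theorem periodic_of_abelian_returns_le_card {α : Type*} [Fintype α]
    (k : ℕ) (hk : Fintype.card α = k)
    (w : ℕ → α) (hall : ∀ a : α, ∃ n, w n = a) (hrec : Recurrent w)
    (h : ∀ u : List α, IsFactor w u → (abelianReturnClasses w u).encard ≤ (k : ℕ∞)) :
    Periodic w := by
  classical
  choose p hp using hall
  obtain ⟨n, hn, hper⟩ := hrec.exists_pos_forall_lt (Finset.univ.sup p + 1)
  by_contra hnp
  have hex : ∃ m, w (m + n) ≠ w m := by
    by_contra! hall
    exact hnp ⟨n, hn, hall⟩
  have hmin : ∀ i < Nat.find hex, w (i + n) = w i := fun i hi =>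
    not_not.1 (Nat.find_min hex hi)
  have hu := isFactor_factorAt w 0 n
  have hocc : ∀ i ≤ Nat.find hex, i ∈ AbelianOccurrences w (factorAt w 0 n) := by
    simpa [AbelianOccurrences] using factorAt_perm_of_forall_lt hmin
  have hlast : Nat.find hex + 1 ∉ AbelianOccurrences w (factorAt w 0 n) := by
    intro hmem
    refine Nat.find_spec hex ((factorAt_succ_perm_iff w _ n).1 ?_)
    simp only [AbelianOccurrences, length_factorAt, Set.mem_ofPred_eq] at hmem
    exact hmem.trans (factorAt_perm_of_forall_lt hmin _ le_rfl).symm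
  obtain ⟨r, hr, hcard⟩ :=
    hrec.exists_one_lt_card_mem_abelianReturnClasses hu (hocc _ le_rfl) hlast
  have hsub : insert r (Set.range fun a : α => ({a} : Multiset α)) ⊆
      abelianReturnClasses w (factorAt w 0 n) := by
    rintro _ (rfl | ⟨a, rfl⟩)
    · exact hr
    · have hlt : p a < Nat.find hex := by
        by_contra! hle
        have : p a ≤ Finset.univ.sup p := Finset.le_sup (Finset.mem_univ a)
        exact Nat.find_spec hex (hper _ (by omega))
      simpa [hp] using singleton_mem_abelianReturnClasses (hocc _ hlt.le) (hocc _ hlt)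
  have hnot : r ∉ Set.range fun a : α => ({a} : Multiset α) := by
    rintro ⟨a, rfl⟩
    simp at hcard
  have hle := (Set.encard_le_encard hsub).trans (h _ hu)
  rw [Set.encard_insert_of_notMem hnot, ← Set.image_univ,
    Function.Injective.encard_image (fun _ _ => Multiset.singleton_inj.1), Set.encard_univ,
    ENat.card_eq_coe_fintype_card, hk] at hle
  exact absurd (by exact_mod_cast hle : k + 1 ≤ k) (by omega)
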